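/- arXiv:2601.09455 — 3 statements merged into one kernel-verified Lean document; each statement's English description precedes it below -/
import Mathlib

section
/- Let φ be a 3-CNF formula over n Boolean variables and let M > 0. Then φ is satisfiable if and only if there exists a binary pair (y, z) with h_{φ,M}(y,z) = 0. -/
open Finset

/-- A literal over variables indexed by `Fin n`: a variable index and a polarity. -/
abbrev Lit (n : ℕ) := Fin n × Bool

/-- A clause: a triple of literals. -/
abbrev Clause (n : ℕ) := Lit n × Lit n × Lit n

/-- A 3-CNF formula: a finite list of clauses. -/
abbrev CNF (n : ℕ) := List (Clause n)

/-- The literal indicator at the pair `(y, z)`. -/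
def litInd {n : ℕ} (y z : Fin n → ℝ) (ℓ : Lit n) : ℝ :=
  if ℓ.2 then y ℓ.1 else z ℓ.1

/-- The one-hidden-layer ReLU regressor `h_{φ,M}`. -/
def hReg {n : ℕ} (φ : CNF n) (M : ℝ) (y z : Fin n → ℝ) : ℝ :=
  M * (φ.map (fun C =>
        max 0 (1 - litInd y z C.1 - litInd y z C.2.1 - litInd y z C.2.2))).sum
    + M * ∑ i, max 0 (y i + z i - 1)

/-- A vector is binary if all of its entries lie in `{0, 1}`. -/
def BinaryVec {n : ℕ} (x : Fin n → ℝ) : Prop := ∀ i, x i = 0 ∨ x i = 1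

/-- An assignment satisfies a literal `(i, b)` iff `σ i = b`. -/
abbrev litSat {n : ℕ} (σ : Fin n → Bool) (ℓ : Lit n) : Prop := σ ℓ.1 = ℓ.2

/-- An assignment satisfies a clause iff it satisfies one of its three literals. -/
abbrev clauseSat {n : ℕ} (σ : Fin n → Bool) (C : Clause n) : Prop :=
  litSat σ C.1 ∨ litSat σ C.2.1 ∨ litSat σ C.2.2

/-- An assignment satisfies a 3-CNF formula iff it satisfies every clause. -/
def cnfSat {n : ℕ} (σ : Fin n → Bool) (φ : CNF n) : Prop := ∀ C ∈ φ, clauseSat σ C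

theorem sum_map_max_zero_nonneg {α : Type*} (l : List α) (f : α → ℝ) :
    0 ≤ (l.map fun a => max 0 (f a)).sum :=
  List.sum_nonneg (by simp)

theorem sum_map_max_zero_eq_zero_iff {α : Type*} (l : List α) (f : α → ℝ) :
    (l.map fun a => max 0 (f a)).sum = 0 ↔ ∀ a ∈ l, f a ≤ 0 := by
  induction l with
  | nil => simp
  | cons a l ih =>
    rw [List.map_cons, List.sum_cons, add_eq_zero_iff_of_nonneg (le_max_left _ _)
      (sum_map_max_zero_nonneg l f), ih]
    simp

/-- The regressor vanishes exactly when all of its ReLU units are inactive. -/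
theorem hReg_eq_zero_iff {n : ℕ} (φ : CNF n) {M : ℝ} (hM : 0 < M) (y z : Fin n → ℝ) :
    hReg φ M y z = 0 ↔
      (∀ C ∈ φ, 1 - litInd y z C.1 - litInd y z C.2.1 - litInd y z C.2.2 ≤ 0) ∧
        ∀ i, y i + z i - 1 ≤ 0 := by
  have hyz : 0 ≤ ∑ i, max 0 (y i + z i - 1) :=
    Finset.sum_nonneg fun _ _ => le_max_left _ _
  rw [hReg, ← mul_add, mul_eq_zero_iff_left hM.ne',
    add_eq_zero_iff_of_nonneg (sum_map_max_zero_nonneg _ _) hyz,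
    sum_map_max_zero_eq_zero_iff,
    Finset.sum_eq_zero_iff_of_nonneg fun _ _ => le_max_left _ _]
  simp only [Finset.mem_univ, true_implies, max_eq_left_iff]

theorem litInd_indicator {n : ℕ} (σ : Fin n → Bool) (ℓ : Lit n) :
    litInd (fun i => if σ i then 1 else 0) (fun i => if σ i then 0 else 1) ℓ =
      if litSat σ ℓ then 1 else 0 := by
  obtain ⟨i, b⟩ := ℓ
  cases b <;> by_cases h : σ i = true <;> simp [litInd, litSat, h]

/-- If `y i + z i ≤ 1` for all `i`, then a literal falsified by the assignment `i ↦ (y i = 1)`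
has indicator `0`. -/
theorem litInd_eq_zero_of_not_litSat {n : ℕ} {y z : Fin n → ℝ} (hy : BinaryVec y)
    (hz : BinaryVec z) (hyz : ∀ i, y i + z i - 1 ≤ 0) {ℓ : Lit n}
    (h : ¬ litSat (fun i => decide (y i = 1)) ℓ) : litInd y z ℓ = 0 := by
  obtain ⟨i, b⟩ := ℓ
  cases b
  · have hyi : y i = 1 := by simpa [litSat] using h
    have hi := hyz i
    rcases hz i with hzi | hzi
    · simpa [litInd] using hzi
    · linarith
  · have hyi : y i ≠ 1 := by simpa [litSat] using h
    simpa [litInd] using (hy i).resolve_right hyi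

/-- `φ` is satisfiable iff some binary pair is mapped to `0` by `h_{φ,M}`. -/
theorem satisfiable_iff_exists_hReg_zero {n : ℕ} (φ : CNF n) (M : ℝ) (hM : 0 < M) :
    (∃ σ : Fin n → Bool, cnfSat σ φ) ↔
      ∃ y z : Fin n → ℝ, BinaryVec y ∧ BinaryVec z ∧ hReg φ M y z = 0 := by
  simp only [hReg_eq_zero_iff φ hM]
  constructor
  · rintro ⟨σ, hσ⟩
    refine ⟨fun i => if σ i then 1 else 0, fun i => if σ i then 0 else 1,
      fun i => ?_, fun i => ?_, fun C hC => ?_, fun i => ?_⟩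
    · cases σ i <;> simp
    · cases σ i <;> simp
    · simp only [litInd_indicator]
      have hsat := hσ C hC
      split_ifs <;> first | tauto | norm_num
    · by_cases h : σ i = true <;> simp [h]
  · rintro ⟨y, z, hy, hz, hφ, hyz⟩
    refine ⟨fun i => decide (y i = 1), fun C hC => ?_⟩
    by_contra hunsat
    simp only [clauseSat, not_or] at hunsat
    have hC' := hφ C hC
    rw [litInd_eq_zero_of_not_litSat hy hz hyz hunsat.1,
      litInd_eq_zero_of_not_litSat hy hz hyz hunsat.2.1,
      litInd_eq_zero_of_not_litSat hy hz hyz hunsat.2.2] at hC'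
    norm_num at hC'
end

section
/- Let φ be a 3-CNF formula over n Boolean variables, let B, K ≥ 0 be reals, set M = √(B·K) + 1, let C be a cost function on binary pairs with 0 ≤ C(y,z) ≤ B for all binary pairs (y,z), and define f(y,z) = (h_{φ,M}(y,z))² + C(y,z). Suppose (y*, z*) is a binary pair such that f(y*,z*) ≤ K · f(y,z) for every binary pair (y,z) (a K-approximate minimizer of f over binary pairs). Then h_{φ,M}(y*,z*) = 0 if and only if φ is satisfiable; moreover, if φ is satisfiable then the assignment σ defined by σ i = true iff y* i = 1 satisfies φ. -/
open Finset

lemma exists_nat_hReg_eq {n : ℕ} (φ : CNF n) (M : ℝ) {y z : Fin n → ℝ}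
    (hy : BinaryVec y) (hz : BinaryVec z) : ∃ k : ℕ, hReg φ M y z = M * k := by
  have hlit : ∀ ℓ : Lit n, litInd y z ℓ = 0 ∨ litInd y z ℓ = 1 := by
    intro ℓ
    unfold litInd
    split_ifs
    exacts [hy _, hz _]
  have hclauses : (φ.map (fun C =>
      max 0 (1 - litInd y z C.1 - litInd y z C.2.1 - litInd y z C.2.2))).sum
        ∈ AddMonoidHom.mrange (Nat.castAddMonoidHom ℝ) := by
    refine AddSubmonoid.list_sum_mem _ fun x hx => ?_
    obtain ⟨C, -, rfl⟩ := List.mem_map.1 hx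
    rcases hlit C.1 with h1 | h1 <;> rcases hlit C.2.1 with h2 | h2 <;>
      rcases hlit C.2.2 with h3 | h3 <;> rw [h1, h2, h3]
    · exact ⟨1, by norm_num⟩
    all_goals exact ⟨0, by norm_num⟩
  have hvars : ∑ i, max 0 (y i + z i - 1)
      ∈ AddMonoidHom.mrange (Nat.castAddMonoidHom ℝ) := by
    refine AddSubmonoid.sum_mem _ fun i _ => ?_
    rcases hy i with h1 | h1 <;> rcases hz i with h2 | h2 <;> rw [h1, h2]
    on_goal 4 => exact ⟨1, by norm_num⟩
    all_goals exact ⟨0, by norm_num⟩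
  obtain ⟨k, hk⟩ := AddSubmonoid.add_mem _ hclauses hvars
  refine ⟨k, ?_⟩
  rw [hReg, ← mul_add, ← hk]
  rfl

lemma cnfSat_of_hReg_eq_zero {n : ℕ} {φ : CNF n} {M : ℝ} (hM : 0 < M) {y z : Fin n → ℝ}
    (hy : BinaryVec y) (hz : BinaryVec z) (h : hReg φ M y z = 0) :
    cnfSat (fun i => decide (y i = 1)) φ := by
  have hclauses_nonneg : ∀ x ∈ φ.map (fun C =>
      max 0 (1 - litInd y z C.1 - litInd y z C.2.1 - litInd y z C.2.2)), (0 : ℝ) ≤ x := by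
    intro x hx
    obtain ⟨C, -, rfl⟩ := List.mem_map.1 hx
    exact le_max_left _ _
  have hvars_nonneg : ∀ i ∈ (univ : Finset (Fin n)), 0 ≤ max 0 (y i + z i - 1) :=
    fun i _ => le_max_left _ _
  rw [hReg, ← mul_add, mul_eq_zero, or_iff_right hM.ne',
    add_eq_zero_iff_of_nonneg (List.sum_nonneg hclauses_nonneg)
      (Finset.sum_nonneg hvars_nonneg),
    Finset.sum_eq_zero_iff_of_nonneg hvars_nonneg] at h
  obtain ⟨hclauses, hvars⟩ := h
  have hlit : ∀ ℓ : Lit n, ¬ litSat (fun i => decide (y i = 1)) ℓ → litInd y z ℓ = 0 := by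
    rintro ⟨i, b⟩ hℓ
    have hi := max_eq_left_iff.1 (hvars i (mem_univ i))
    cases b
    · have hyi : y i = 1 := by simpa [litSat] using hℓ
      have hzi : z i ≠ 1 := by
        intro hzi
        norm_num [hyi, hzi] at hi
      simpa [litInd] using (hz i).resolve_right hzi
    · have hyi : y i ≠ 1 := by simpa [litSat] using hℓ
      simpa [litInd] using (hy i).resolve_right hyi
  intro C hC
  by_contra hsat
  simp only [clauseSat, not_or] at hsat
  have hle := List.single_le_sum hclauses_nonneg _ (List.mem_map_of_mem hC)
  rw [hclauses, hlit _ hsat.1, hlit _ hsat.2.1, hlit _ hsat.2.2] at hle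
  norm_num at hle

lemma hReg_eq_zero_of_cnfSat {n : ℕ} {φ : CNF n} (M : ℝ) {σ : Fin n → Bool}
    (hσ : cnfSat σ φ) :
    hReg φ M (fun i => if σ i then 1 else 0) (fun i => if σ i then 0 else 1) = 0 := by
  have hlit : ∀ ℓ : Lit n, litInd (fun i => if σ i then 1 else 0)
      (fun i => if σ i then 0 else 1) ℓ = if litSat σ ℓ then 1 else 0 := by
    rintro ⟨i, b⟩
    by_cases h : σ i <;> cases b <;> simp [litInd, litSat, h]
  have hclauses : (φ.map (fun C => max (0 : ℝ) (1
      - litInd (fun i => if σ i then 1 else 0) (fun i => if σ i then 0 else 1) C.1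
      - litInd (fun i => if σ i then 1 else 0) (fun i => if σ i then 0 else 1) C.2.1
      - litInd (fun i => if σ i then 1 else 0) (fun i => if σ i then 0 else 1) C.2.2))).sum
        = 0 := by
    refine List.sum_eq_zero fun x hx => ?_
    obtain ⟨C, hC, rfl⟩ := List.mem_map.1 hx
    have hsat := hσ C hC
    rw [hlit, hlit, hlit, max_eq_left_iff]
    unfold clauseSat at hsat
    split_ifs <;> first | tauto | norm_num
  rw [hReg, hclauses, Finset.sum_eq_zero, mul_zero, add_zero]
  intro i _
  cases σ i <;> simp

/-- for the Wachter-style objective `f(y,z) = (h_{φ,M}(y,z))² + Cost(y,z)` with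
`M = √(B·K) + 1` and `0 ≤ Cost ≤ B` on binary pairs, any `K`-approximate minimizer `(y*,z*)`
over binary pairs satisfies `h_{φ,M}(y*,z*) = 0` iff `φ` is satisfiable; and if `φ` is
satisfiable, the assignment `σ i = true ↔ y* i = 1` satisfies `φ`. -/
theorem approx_min_hReg_sat {n : ℕ} (φ : CNF n) (B K : ℝ) (hB : 0 ≤ B) (hK : 0 ≤ K)
    (Cost : (Fin n → ℝ) → (Fin n → ℝ) → ℝ)
    (hCost : ∀ y z : Fin n → ℝ, BinaryVec y → BinaryVec z → 0 ≤ Cost y z ∧ Cost y z ≤ B)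
    (ys zs : Fin n → ℝ) (hys : BinaryVec ys) (hzs : BinaryVec zs)
    (happrox : ∀ y z : Fin n → ℝ, BinaryVec y → BinaryVec z →
      (hReg φ (Real.sqrt (B * K) + 1) ys zs) ^ 2 + Cost ys zs ≤
        K * ((hReg φ (Real.sqrt (B * K) + 1) y z) ^ 2 + Cost y z)) :
    (hReg φ (Real.sqrt (B * K) + 1) ys zs = 0 ↔ ∃ σ : Fin n → Bool, cnfSat σ φ) ∧
      ((∃ σ : Fin n → Bool, cnfSat σ φ) → cnfSat (fun i => decide (ys i = 1)) φ) := by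
  have hM : 0 < Real.sqrt (B * K) + 1 := by positivity
  have hzero : (∃ σ : Fin n → Bool, cnfSat σ φ) →
      hReg φ (Real.sqrt (B * K) + 1) ys zs = 0 := by
    rintro ⟨σ, hσ⟩
    have hy : BinaryVec (fun i => if σ i then (1 : ℝ) else 0) := by
      intro i
      cases σ i <;> simp
    have hz : BinaryVec (fun i => if σ i then (0 : ℝ) else 1) := by
      intro i
      cases σ i <;> simp
    have happ := happrox _ _ hy hz
    rw [hReg_eq_zero_of_cnfSat _ hσ] at happ
    have hsq : hReg φ (Real.sqrt (B * K) + 1) ys zs ^ 2 ≤ B * K := by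
      have hcost := mul_le_mul_of_nonneg_left (hCost _ _ hy hz).2 hK
      have hcost_nonneg := (hCost _ _ hys hzs).1
      linarith
    have hlt : hReg φ (Real.sqrt (B * K) + 1) ys zs < Real.sqrt (B * K) + 1 :=
      (Real.le_sqrt_of_sq_le hsq).trans_lt (lt_add_one _)
    obtain ⟨k, hk⟩ := exists_nat_hReg_eq φ (Real.sqrt (B * K) + 1) hys hzs
    rw [hk, mul_lt_iff_lt_one_right hM, Nat.cast_lt_one] at hlt
    rw [hk, hlt, Nat.cast_zero, mul_zero]
  exact ⟨⟨fun h => ⟨_, cnfSat_of_hReg_eq_zero hM hys hzs h⟩, hzero⟩,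
    fun h => cnfSat_of_hReg_eq_zero hM hys hzs (hzero h)⟩
end

section
/- Let φ be a 3-CNF formula over n Boolean variables with c ≥ 1 clauses, let B, K ≥ 0 be reals, set M = √(B·K) + 1, let C be a cost function on binary vectors with 0 ≤ C(x) ≤ B for all binary x, and define f(x) = (g_{φ,M}(x))² + C(x). Suppose x* is a binary vector such that f(x*) ≤ K · f(x) for every binary vector x (a K-approximate minimizer of f over binary vectors). Then g_{φ,M}(x*) = 0 if and only if φ is satisfiable; moreover, if φ is satisfiable then the assignment σ defined by σ i = true iff x* i = 1 satisfies φ. -/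
open Finset

/-- The Boolean assignment read off from a real vector: `σ_x i = true` iff `x i = 1`. -/
noncomputable def assignOf {n : ℕ} (x : Fin n → ℝ) : Fin n → Bool := fun i => decide (x i = 1)

/-- The additive tree model regressor `g_{φ,M}`: the average over the clauses of the
per-clause tree outputs (`0` if the clause is satisfied by `σ_x`, `c·M` otherwise). -/
noncomputable def gReg {n : ℕ} (φ : CNF n) (M : ℝ) (x : Fin n → ℝ) : ℝ :=
  (φ.map (fun C =>
      if clauseSat (assignOf x) C then 0 else (φ.length : ℝ) * M)).sum / (φ.length : ℝ)

theorem gReg_eq_zero_of_cnfSat {n : ℕ} {φ : CNF n} {x : Fin n → ℝ} (M : ℝ)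
    (h : cnfSat (assignOf x) φ) : gReg φ M x = 0 := by
  have hsum : (φ.map (fun C =>
      if clauseSat (assignOf x) C then 0 else (φ.length : ℝ) * M)).sum = 0 := by
    refine List.sum_eq_zero fun a ha => ?_
    obtain ⟨C, hC, rfl⟩ := List.mem_map.1 ha
    exact if_pos (h C hC)
  rw [gReg, hsum, zero_div]

theorem le_gReg_of_not_cnfSat {n : ℕ} {φ : CNF n} {x : Fin n → ℝ} {M : ℝ} (hM : 0 ≤ M)
    (h : ¬ cnfSat (assignOf x) φ) : M ≤ gReg φ M x := by
  simp only [cnfSat, not_forall] at h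
  obtain ⟨C, hC, hsat⟩ := h
  have hpos : (0 : ℝ) < φ.length := by exact_mod_cast List.length_pos_of_mem hC
  rw [gReg, le_div_iff₀ hpos, mul_comm]
  refine List.single_le_sum (fun a ha => ?_) _ (List.mem_map.2 ⟨C, hC, if_neg hsat⟩)
  obtain ⟨D, -, rfl⟩ := List.mem_map.1 ha
  split_ifs <;> positivity

theorem gReg_eq_zero_iff {n : ℕ} {φ : CNF n} {x : Fin n → ℝ} {M : ℝ} (hM : 0 < M) :
    gReg φ M x = 0 ↔ cnfSat (assignOf x) φ := by
  refine ⟨fun h => ?_, gReg_eq_zero_of_cnfSat M⟩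
  by_contra hsat
  exact (hM.trans_le (le_gReg_of_not_cnfSat hM.le hsat)).ne' h

theorem exists_binaryVec_assignOf_eq {n : ℕ} (σ : Fin n → Bool) :
    ∃ x : Fin n → ℝ, BinaryVec x ∧ assignOf x = σ := by
  refine ⟨fun i => if σ i then 1 else 0, fun i => ?_, funext fun i => ?_⟩
  · cases h : σ i <;> simp [h]
  · cases h : σ i <;> simp [assignOf, h]

/-- for the Wachter-style objective `f(x) = (g_{φ,M}(x))² + Cost(x)` with
`M = √(B·K) + 1` and `0 ≤ Cost ≤ B` on binary vectors, any `K`-approximate minimizer `x*`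
over binary vectors satisfies `g_{φ,M}(x*) = 0` iff `φ` is satisfiable; and if `φ` is
satisfiable, the assignment `σ_x*` satisfies `φ`. -/
theorem approx_min_gReg_sat {n : ℕ} (φ : CNF n) (hc : 1 ≤ φ.length)
    (B K : ℝ) (hB : 0 ≤ B) (hK : 0 ≤ K)
    (Cost : (Fin n → ℝ) → ℝ)
    (hCost : ∀ x : Fin n → ℝ, BinaryVec x → 0 ≤ Cost x ∧ Cost x ≤ B)
    (xs : Fin n → ℝ) (hxs : BinaryVec xs)
    (happrox : ∀ x : Fin n → ℝ, BinaryVec x →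
      (gReg φ (Real.sqrt (B * K) + 1) xs) ^ 2 + Cost xs ≤
        K * ((gReg φ (Real.sqrt (B * K) + 1) x) ^ 2 + Cost x)) :
    (gReg φ (Real.sqrt (B * K) + 1) xs = 0 ↔ ∃ σ : Fin n → Bool, cnfSat σ φ) ∧
      ((∃ σ : Fin n → Bool, cnfSat σ φ) → cnfSat (assignOf xs) φ) := by
  have hM : 0 < Real.sqrt (B * K) + 1 := by positivity
  have hsat : (∃ σ : Fin n → Bool, cnfSat σ φ) → cnfSat (assignOf xs) φ := by
    rintro ⟨σ, hσ⟩
    obtain ⟨x, hx, rfl⟩ := exists_binaryVec_assignOf_eq σ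
    by_contra hns
    have hle := happrox x hx
    rw [gReg_eq_zero_of_cnfSat _ hσ] at hle
    have hg := pow_le_pow_left₀ hM.le (le_gReg_of_not_cnfSat hM.le hns) 2
    have hKC := mul_le_mul_of_nonneg_left (hCost x hx).2 hK
    have hsq := Real.sq_sqrt (mul_nonneg hB hK)
    nlinarith [(hCost xs hxs).1, Real.sqrt_nonneg (B * K)]
  rw [gReg_eq_zero_iff hM]
  exact ⟨⟨fun h => ⟨_, h⟩, hsat⟩, hsat⟩
end
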